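/- Uniform almost sure approximation of the Poisson quasi-log-likelihood by its computable version (claim (6.12) in the proof of Theorem 4.1): Assume the setting below with Assumption A₀(Θ), Assumption (MOD.A0), the moment condition (3.2) with ε ≥ 1, and α_k^{(0)} = O(k^{-γ}) for some γ > 3/2. Then (1/n) sup_{θ∈Θ} | L̂_n(θ) − L_n(θ) | → 0 almost surely as n → ∞. -/

import Mathlib

/-!
Theorem 4.1 of "A general procedure for change-point detection in multivariate
time series" (Diop & Kengne): strong consistency of the Poisson
quasi-maximum likelihood estimator for the class 𝓜𝓞𝓓(f_θ).
-/

open MeasureTheory Filter Finset Topology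

noncomputable section

namespace ChangePointMOD

/-- ℓ¹ norm on `ℝ^p`. -/
def l1 {p : ℕ} (x : Fin p → ℝ) : ℝ := ∑ i, |x i|

/-- ℓ¹ norm of an `ℕ^p`-valued vector. -/
def l1n {p : ℕ} (x : Fin p → ℕ) : ℝ := ∑ i, (x i : ℝ)

/-- ℓ¹ distance between two `ℕ^p`-valued vectors. -/
def l1dist {p : ℕ} (x y : Fin p → ℕ) : ℝ := ∑ i, |(x i : ℝ) - (y i : ℝ)|

/-- The shift on two-sided path space. -/
def shift {α : Type*} (x : ℤ → α) : ℤ → α := fun t => x (t + 1)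

variable {m d : ℕ} {Ω : Type*} [MeasurableSpace Ω]

/-- The infinite past `(Y_{t-1}, Y_{t-2}, …)` of the process at time `t`. -/
def past (Y : ℤ → Ω → Fin m → ℕ) (t : ℤ) (ω : Ω) : ℕ → Fin m → ℕ :=
  fun k => Y (t - 1 - k) ω

/-- The truncated past `(Y_{t-1}, …, Y_1, 0, 0, …)` used for the computable
(quasi-)likelihood. -/
def pastTrunc (Y : ℤ → Ω → Fin m → ℕ) (t : ℤ) (ω : Ω) : ℕ → Fin m → ℕ :=
  fun k => if 1 ≤ t - 1 - (k : ℤ) then Y (t - 1 - k) ω else 0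

/-- σ-algebra generated by `Y_s`, `s ≤ t`. -/
def filt (Y : ℤ → Ω → Fin m → ℕ) (t : ℤ) : MeasurableSpace Ω :=
  ⨆ s : {s : ℤ // s ≤ t}, MeasurableSpace.comap (Y s.1) inferInstance

/-- Summand `ℓ_t(θ)` of the Poisson quasi-log-likelihood. -/
def ell (f : (Fin d → ℝ) → (ℕ → Fin m → ℕ) → Fin m → ℝ) (Y : ℤ → Ω → Fin m → ℕ)
    (θ : Fin d → ℝ) (t : ℤ) (ω : Ω) : ℝ :=
  ∑ i, ((Y t ω i : ℝ) * Real.log (f θ (past Y t ω) i) - f θ (past Y t ω) i)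

/-- Summand `ℓ̂_t(θ)` of the computable Poisson quasi-log-likelihood. -/
def ellHat (f : (Fin d → ℝ) → (ℕ → Fin m → ℕ) → Fin m → ℝ) (Y : ℤ → Ω → Fin m → ℕ)
    (θ : Fin d → ℝ) (t : ℤ) (ω : Ω) : ℝ :=
  ∑ i, ((Y t ω i : ℝ) * Real.log (f θ (pastTrunc Y t ω) i) - f θ (pastTrunc Y t ω) i)

/-- `L_n(θ) = ∑_{t=1}^n ℓ_t(θ)`. -/
def L (f : (Fin d → ℝ) → (ℕ → Fin m → ℕ) → Fin m → ℝ) (Y : ℤ → Ω → Fin m → ℕ)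
    (n : ℕ) (θ : Fin d → ℝ) (ω : Ω) : ℝ :=
  ∑ t ∈ Finset.Icc 1 n, ell f Y θ (t : ℤ) ω

/-- `L̂_n(θ) = ∑_{t=1}^n ℓ̂_t(θ)`. -/
def LHat (f : (Fin d → ℝ) → (ℕ → Fin m → ℕ) → Fin m → ℝ) (Y : ℤ → Ω → Fin m → ℕ)
    (n : ℕ) (θ : Fin d → ℝ) (ω : Ω) : ℝ :=
  ∑ t ∈ Finset.Icc 1 n, ellHat f Y θ (t : ℤ) ω

/-- Running maximum `max (0, S₁ h, …, Sₙ h)` of the Birkhoff sums of `h` under `T`. -/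
def birkhoffMax {X : Type*} (T : X → X) (h : X → ℝ) : ℕ → X → ℝ
  | 0 => fun _ => 0
  | n + 1 => fun x => max 0 (h x + birkhoffMax T h n (T x))

lemma birkhoffMax_nonneg {X : Type*} (T : X → X) (h : X → ℝ) (n : ℕ) (x : X) :
    0 ≤ birkhoffMax T h n x := by
  cases n with
  | zero => exact le_rfl
  | succ n => exact le_max_left _ _

lemma birkhoffMax_le_succ {X : Type*} (T : X → X) (h : X → ℝ) (n : ℕ) (x : X) :
    birkhoffMax T h n x ≤ birkhoffMax T h (n + 1) x := by
  induction n generalizing x with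
  | zero => exact birkhoffMax_nonneg T h 1 x
  | succ n ih => exact max_le_max le_rfl (add_le_add le_rfl (ih (T x)))

lemma birkhoffSum_le_birkhoffMax {X : Type*} (T : X → X) (h : X → ℝ) (n : ℕ) (x : X) :
    birkhoffSum T h n x ≤ birkhoffMax T h n x := by
  induction n generalizing x with
  | zero => simp [birkhoffMax]
  | succ n ih =>
    rw [birkhoffSum_succ']
    exact (add_le_add le_rfl (ih (T x))).trans (le_max_right _ _)

lemma birkhoffMax_le_indicator_add {X : Type*} (T : X → X) (h : X → ℝ) (n : ℕ) (x : X) :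
    birkhoffMax T h n x ≤
      {x | 0 < birkhoffMax T h n x}.indicator h x + birkhoffMax T h n (T x) := by
  by_cases hx : 0 < birkhoffMax T h n x
  · rw [Set.indicator_of_mem (by exact hx)]
    cases n with
    | zero => exact absurd hx (lt_irrefl 0)
    | succ n =>
      have hmax : birkhoffMax T h (n + 1) x = h x + birkhoffMax T h n (T x) := by
        rcases max_choice 0 (h x + birkhoffMax T h n (T x)) with h0 | h0
        · exact absurd hx (by simp only [birkhoffMax, h0, lt_irrefl, not_false_iff])
        · exact h0
      rw [hmax]
      exact add_le_add le_rfl (birkhoffMax_le_succ T h n (T x))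
  · rw [Set.indicator_of_notMem (by exact hx), zero_add]
    exact (not_lt.1 hx).trans (birkhoffMax_nonneg T h n (T x))

section MaximalErgodic

variable {X : Type*} [MeasurableSpace X] {ν : Measure X} {T : X → X} {h : X → ℝ}

lemma measurable_birkhoffMax (hT : Measurable T) (hh : Measurable h) (n : ℕ) :
    Measurable (birkhoffMax T h n) := by
  induction n with
  | zero => exact measurable_const
  | succ n ih => exact measurable_const.max (hh.add (ih.comp hT))

lemma integrable_birkhoffMax (hT : MeasurePreserving T ν ν) (hi : Integrable h ν) (n : ℕ) :
    Integrable (birkhoffMax T h n) ν := by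
  induction n with
  | zero => exact integrable_zero _ _ _
  | succ n ih =>
    exact (integrable_zero X ℝ ν).sup (hi.add (hT.integrable_comp_of_integrable ih))

/-- Maximal ergodic theorem. -/
lemma setIntegral_birkhoffMax_pos_nonneg (hT : MeasurePreserving T ν ν) (hh : Measurable h)
    (hi : Integrable h ν) (n : ℕ) :
    0 ≤ ∫ x in {x | 0 < birkhoffMax T h n x}, h x ∂ν := by
  have hM := measurable_birkhoffMax hT.measurable hh n
  have hMi := integrable_birkhoffMax hT hi n
  have hMT : Integrable (fun x => birkhoffMax T h n (T x)) ν :=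
    hT.integrable_comp_of_integrable hMi
  have hP : MeasurableSet {x | 0 < birkhoffMax T h n x} := measurableSet_lt measurable_const hM
  have hle := integral_mono hMi ((hi.indicator hP).add hMT)
    (birkhoffMax_le_indicator_add T h n)
  have hinv : ∫ x, birkhoffMax T h n (T x) ∂ν = ∫ x, birkhoffMax T h n x ∂ν := by
    rw [← integral_map hT.aemeasurable (by rw [hT.map_eq]; exact hMi.aestronglyMeasurable),
      hT.map_eq]
  rw [integral_add' (hi.indicator hP) hMT, integral_indicator hP, hinv] at hle
  linarith

/-- Birkhoff averages of a nonnegative integrable function are almost surely bounded. -/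
lemma ae_exists_birkhoffSum_le [IsProbabilityMeasure ν] (hT : MeasurePreserving T ν ν)
    {g : X → ℝ} (hg : Measurable g) (hgi : Integrable g ν) (hg0 : ∀ x, 0 ≤ g x) :
    ∀ᵐ x ∂ν, ∃ K : ℝ, ∀ n : ℕ, birkhoffSum T g n x ≤ K * n := by
  set P : ℕ → ℕ → Set X := fun j n => {x | 0 < birkhoffMax T (fun x => g x - (j + 1 : ℝ)) n x}
  have hPj : ∀ j, ν (⋃ n, P j n) ≤ ENNReal.ofReal ((∫ x, g x ∂ν) / (j + 1)) := by
    intro j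
    have hmono : Monotone (P j) := by
      refine monotone_nat_of_le_succ fun n x hx => ?_
      exact lt_of_lt_of_le hx (birkhoffMax_le_succ T _ n x)
    rw [hmono.measure_iUnion]
    refine iSup_le fun n => ?_
    have h0 := setIntegral_birkhoffMax_pos_nonneg hT (hg.sub_const (j + 1 : ℝ))
      (hgi.sub (integrable_const (j + 1 : ℝ))) n
    change 0 ≤ ∫ x in P j n, (g x - (j + 1 : ℝ)) ∂ν at h0
    rw [integral_sub hgi.integrableOn (integrable_const _), setIntegral_const, smul_eq_mul] at h0
    have h1 : ∫ x in P j n, g x ∂ν ≤ ∫ x, g x ∂ν :=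
      setIntegral_le_integral hgi (Eventually.of_forall hg0)
    rw [← ofReal_measureReal]
    refine ENNReal.ofReal_le_ofReal ?_
    rw [le_div_iff₀ (by positivity)]
    linarith
  have hnull : ν (⋂ j, ⋃ n, P j n) = 0 := by
    have hlim : Tendsto (fun j : ℕ => ENNReal.ofReal ((∫ x, g x ∂ν) / (j + 1))) atTop (𝓝 0) := by
      have := (tendsto_const_div_atTop_nhds_zero_nat (∫ x, g x ∂ν)).comp (tendsto_add_atTop_nat 1)
      rw [← ENNReal.ofReal_zero]
      refine (ENNReal.continuous_ofReal.tendsto 0).comp ?_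
      simpa [Function.comp_def] using this
    refine le_antisymm (ge_of_tendsto' hlim fun j => ?_) bot_le
    exact (measure_mono (Set.iInter_subset _ j)).trans (hPj j)
  filter_upwards [measure_eq_zero_iff_ae_notMem.1 hnull] with x hx
  simp only [Set.mem_iInter, Set.mem_iUnion, not_forall, not_exists] at hx
  obtain ⟨j, hj⟩ := hx
  refine ⟨j + 1, fun n => ?_⟩
  have h1 := (birkhoffSum_le_birkhoffMax T (fun x => g x - (j + 1 : ℝ)) n x).trans
    (not_lt.1 (hj n))
  simp only [birkhoffSum, Finset.sum_sub_distrib, Finset.sum_const, Finset.card_range,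
    nsmul_eq_mul] at h1 ⊢
  linarith

end MaximalErgodic

/-- A series of nonnegative random variables with uniformly bounded first moments, weighted by a
summable sequence, converges almost surely. -/
lemma ae_summable_mul (μ : Measure Ω) {N : ℕ → Ω → ℝ} (hN : ∀ j, Measurable (N j))
    (hN0 : ∀ j ω, 0 ≤ N j ω) {A : ENNReal} (hA : A ≠ ⊤)
    (hNA : ∀ j, ∫⁻ ω, ENNReal.ofReal (N j ω) ∂μ ≤ A) {b : ℕ → ℝ} (hb0 : ∀ j, 0 ≤ b j)
    (hb : Summable b) : ∀ᵐ ω ∂μ, Summable fun j => b j * N j ω := by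
  have hfin : ∫⁻ ω, ∑' j, ENNReal.ofReal (b j * N j ω) ∂μ ≠ ⊤ := by
    rw [lintegral_tsum fun j => ((hN j).const_mul (b j)).ennreal_ofReal.aemeasurable]
    refine ne_top_of_le_ne_top (ENNReal.mul_ne_top hb.tsum_ofReal_ne_top hA) ?_
    rw [← ENNReal.tsum_mul_right]
    refine ENNReal.tsum_le_tsum fun j => ?_
    simp_rw [ENNReal.ofReal_mul (hb0 j)]
    rw [lintegral_const_mul _ (hN j).ennreal_ofReal]
    gcongr
    exact hNA j
  filter_upwards [ae_lt_top (Measurable.tsum fun j =>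
    ((hN j).const_mul (b j)).ennreal_ofReal) hfin] with ω hω
  have := ENNReal.summable_toReal hω.ne
  simpa [ENNReal.toReal_ofReal, mul_nonneg, hb0, hN0] using this

lemma tendsto_tsum_shift_mul {a N : ℕ → ℝ} {γ : ℝ} (hγ : 0 ≤ γ) (ha0 : ∀ k, 0 ≤ a k)
    (hN0 : ∀ j, 0 ≤ N j) (ha : a =O[atTop] fun k : ℕ => (k : ℝ) ^ (-γ))
    (hlim : Tendsto a atTop (𝓝 0))
    (hsum : Summable fun j : ℕ => ((j + 1 : ℕ) : ℝ) ^ (-γ) * N j) :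
    Tendsto (fun t => ∑' j, a (t + j) * N j) atTop (𝓝 0) := by
  obtain ⟨K, hK, hbd⟩ := ha.exists_pos
  obtain ⟨k₀, hk₀⟩ := eventually_atTop.1 hbd.bound
  have key := tendsto_tsum_of_dominated_convergence (𝓕 := atTop)
    (f := fun t j => a (t + j) * N j) (g := fun _ => (0 : ℝ)) (hsum.mul_left K)
    (fun j => by
      simpa using (hlim.comp (tendsto_add_atTop_nat j)).mul_const (N j)) ?_
  · simpa using key
  · filter_upwards [eventually_ge_atTop (max 1 k₀)] with t ht j
    have h1 := hk₀ (t + j) (by omega)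
    rw [Real.norm_of_nonneg (ha0 _), Real.norm_of_nonneg (by positivity)] at h1
    rw [Real.norm_of_nonneg (mul_nonneg (ha0 _) (hN0 j)), ← mul_assoc]
    refine mul_le_mul_of_nonneg_right (h1.trans ?_) (hN0 j)
    refine mul_le_mul_of_nonneg_left ?_ hK.le
    exact Real.rpow_le_rpow_of_nonpos (by positivity) (by exact_mod_cast (by omega)) (by linarith)

/-- Weighted Cesàro convergence. -/
lemma tendsto_weighted_average {w r : ℕ → ℝ} (hw : ∀ s, 1 ≤ w s) {K : ℝ}
    (hK : ∀ n : ℕ, ∑ s ∈ range n, w s ≤ K * n) (hr : Tendsto r atTop (𝓝 0)) :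
    Tendsto (fun n : ℕ => (1 / (n : ℝ)) * ∑ s ∈ range n, w s * r s) atTop (𝓝 0) := by
  have hlo : (fun s => w s * r s) =o[atTop] w := by
    simpa using (Asymptotics.isBigO_refl w atTop).mul_isLittleO
      ((Asymptotics.isLittleO_one_iff ℝ).2 hr)
  have hge : ∀ n : ℕ, (n : ℝ) ≤ ∑ s ∈ range n, w s := fun n => by
    simpa using Finset.sum_le_sum fun s (_ : s ∈ range n) => hw s
  have hsum := hlo.sum_range (fun s => zero_le_one.trans (hw s))
    (tendsto_atTop_mono hge tendsto_natCast_atTop_atTop)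
  have hO : (fun n => ∑ s ∈ range n, w s) =O[atTop] fun n : ℕ => (n : ℝ) := by
    refine Asymptotics.IsBigO.of_bound K (Eventually.of_forall fun n => ?_)
    rw [Real.norm_of_nonneg ((Nat.cast_nonneg n).trans (hge n)),
      Real.norm_of_nonneg (Nat.cast_nonneg n)]
    exact hK n
  refine (hsum.trans_isBigO hO).tendsto_div_nhds_zero.congr fun n => ?_
  rw [div_eq_inv_mul, one_div]

lemma abs_log_sub_log_le {c a b : ℝ} (hc : 0 < c) (ha : c ≤ a) (hb : c ≤ b) :
    |Real.log a - Real.log b| ≤ |a - b| / c := by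
  have aux : ∀ {x y : ℝ}, c ≤ x → c ≤ y → Real.log x - Real.log y ≤ |x - y| / c := by
    intro x y hx hy
    have hx0 := hc.trans_le hx
    have hy0 := hc.trans_le hy
    rw [← Real.log_div hx0.ne' hy0.ne']
    calc Real.log (x / y) ≤ x / y - 1 := Real.log_le_sub_one_of_pos (by positivity)
      _ = (x - y) / y := by field_simp
      _ ≤ |x - y| / y := by gcongr; exact le_abs_self _
      _ ≤ |x - y| / c := by gcongr
  rw [abs_le]
  refine ⟨?_, aux ha hb⟩
  have := aux hb ha
  rw [abs_sub_comm] at this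
  linarith

lemma l1n_nonneg {p : ℕ} (x : Fin p → ℕ) : 0 ≤ l1n x :=
  Finset.sum_nonneg fun _ _ => Nat.cast_nonneg _

lemma measurable_l1n {p : ℕ} : Measurable (l1n : (Fin p → ℕ) → ℝ) :=
  measurable_of_countable _

lemma abs_poisson_sub_le {p : ℕ} {c : ℝ} (hc : 0 < c) (y : Fin p → ℕ) {u v : Fin p → ℝ}
    (hu : ∀ i, c ≤ u i) (hv : ∀ i, c ≤ v i) :
    |∑ i, ((y i : ℝ) * Real.log (u i) - u i) - ∑ i, ((y i : ℝ) * Real.log (v i) - v i)| ≤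
      (1 + l1n y / c) * l1 fun i => u i - v i := by
  rw [← Finset.sum_sub_distrib, l1, Finset.mul_sum]
  refine (Finset.abs_sum_le_sum_abs _ _).trans (Finset.sum_le_sum fun i _ => ?_)
  have hy : (y i : ℝ) ≤ l1n y :=
    Finset.single_le_sum (f := fun i => (y i : ℝ)) (fun _ _ => Nat.cast_nonneg _)
      (Finset.mem_univ i)
  calc |(y i : ℝ) * Real.log (u i) - u i - ((y i : ℝ) * Real.log (v i) - v i)|
      = |(y i : ℝ) * (Real.log (u i) - Real.log (v i)) - (u i - v i)| := by congr 1; ring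
    _ ≤ |(y i : ℝ) * (Real.log (u i) - Real.log (v i))| + |u i - v i| := abs_sub _ _
    _ = y i * |Real.log (u i) - Real.log (v i)| + |u i - v i| := by
        rw [abs_mul, Nat.abs_cast]
    _ ≤ l1n y * (|u i - v i| / c) + |u i - v i| := by
        gcongr
        · exact l1n_nonneg y
        · exact abs_log_sub_log_le hc (hu i) (hv i)
    _ = (1 + l1n y / c) * |u i - v i| := by ring

/-- The truncation error of the past at time `s + 1` involves only the coordinates `Y_{-j}`. -/
lemma tsum_past_trunc {S : Type*} (Y : ℤ → S → Fin m → ℕ) (a : ℕ → ℝ) (s : ℕ) (ω : S) :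
    ∑' k, ENNReal.ofReal
        (a k * l1dist (pastTrunc Y ((s + 1 : ℕ) : ℤ) ω k) (past Y ((s + 1 : ℕ) : ℤ) ω k)) =
      ∑' j : ℕ, ENNReal.ofReal (a (s + j) * l1n (Y (-(j : ℤ)) ω)) := by
  rw [← Summable.sum_add_tsum_nat_add' (k := s) ENNReal.summable,
    Finset.sum_eq_zero, zero_add]
  · refine tsum_congr fun j => ?_
    rw [add_comm j s]
    have h1 : ¬ (1 ≤ -(j : ℤ)) := by omega
    have h2 : ((s + 1 : ℕ) : ℤ) - 1 - ((s + j : ℕ) : ℤ) = -(j : ℤ) := by omega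
    simp only [pastTrunc, past, h2, if_neg h1, l1dist, l1n, Pi.zero_apply, Nat.cast_zero, zero_sub,
      abs_neg, Nat.abs_cast]
  · intro k hk
    have hk' := Finset.mem_range.1 hk
    have h1 : 1 ≤ ((s + 1 : ℕ) : ℤ) - 1 - (k : ℤ) := by omega
    simp only [pastTrunc, past, if_pos h1, l1dist, sub_self, abs_zero, Finset.sum_const_zero,
      mul_zero, ENNReal.ofReal_zero]

lemma lintegral_comp_eq_of_stationary {μ : Measure Ω} {Y : ℤ → Ω → Fin m → ℕ}
    (hY : ∀ t, Measurable (Y t))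
    (hstat : MeasurePreserving shift (μ.map fun ω (t : ℤ) => Y t ω) (μ.map fun ω t => Y t ω))
    {g : (Fin m → ℕ) → ENNReal} (hg : Measurable g) (t : ℤ) :
    ∫⁻ ω, g (Y t ω) ∂μ = ∫⁻ ω, g (Y 0 ω) ∂μ := by
  have hpath : Measurable fun ω (t : ℤ) => Y t ω := measurable_pi_lambda _ hY
  have step : ∀ t : ℤ, ∫⁻ ω, g (Y (t + 1) ω) ∂μ = ∫⁻ ω, g (Y t ω) ∂μ := by
    intro t
    have hgt : ∀ t : ℤ, Measurable fun x : ℤ → Fin m → ℕ => g (x t) := fun t =>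
      hg.comp (measurable_pi_apply t)
    have h1 := hstat.lintegral_comp (hgt t)
    rw [lintegral_map (hgt t) hpath] at h1
    rw [← h1]
    exact (lintegral_map (hgt (t + 1)) hpath).symm
  induction t using Int.induction_on with
  | zero => rfl
  | succ i ih => rw [step, ih]
  | pred i ih => rw [← ih, ← step (-(i : ℤ) - 1), sub_add_cancel]

lemma birkhoffSum_shift {p : ℕ} (x : ℤ → Fin p → ℕ) (n : ℕ) :
    birkhoffSum shift (fun x : ℤ → Fin p → ℕ => l1n (x 1)) n x =
      ∑ s ∈ range n, l1n (x ((s + 1 : ℕ) : ℤ)) := by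
  have hit : ∀ (s : ℕ) (t : ℤ), shift^[s] x t = x (t + s) := by
    intro s
    induction s with
    | zero => intro t; simp
    | succ s ih =>
      intro t
      rw [Function.iterate_succ_apply', shift, ih]
      congr 1
      push_cast
      ring
  refine Finset.sum_congr rfl fun s _ => ?_
  change l1n (shift^[s] x 1) = _
  rw [hit, Nat.cast_succ, add_comm]

/-- Claim (6.12) in the proof of Theorem 4.1: uniform a.s. approximation of the
Poisson quasi-log-likelihood by its computable version. -/
theorem likelihood_uniform_approx
    (μ : Measure Ω) [IsProbabilityMeasure μ]
    (Θ : Set (Fin d → ℝ)) (hΘcomp : IsCompact Θ)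
    (θstar : Fin d → ℝ) (hθstar : θstar ∈ Θ)
    (f : (Fin d → ℝ) → (ℕ → Fin m → ℕ) → Fin m → ℝ)
    (Y : ℤ → Ω → Fin m → ℕ)
    (hYmeas : ∀ t, Measurable (Y t))
    -- (Y_t) is stationary and ergodic
    (herg : Ergodic shift (μ.map fun ω (t : ℤ) => Y t ω))
    -- f takes nonnegative values
    (hfpos : ∀ θ y i, 0 ≤ f θ y i)
    -- E(Y_t | 𝓕_{t-1}) = f_{θ*}(Y_{t-1}, Y_{t-2}, …)
    (hcond : ∀ t : ℤ, ∀ i,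
      μ[(fun ω => (Y t ω i : ℝ)) | filt Y (t - 1)] =ᵐ[μ]
        fun ω => f θstar (past Y t ω) i)
    -- moment condition (3.2) with ε ≥ 1
    (C ε : ℝ) (hC : 0 < C) (hε : 1 ≤ ε)
    (hmom : ∀ t : ℤ, (∫ ω, (l1n (Y t ω)) ^ (1 + ε) ∂μ) ^ (1 / (1 + ε)) < C)
    -- Assumption A₀(Θ): continuity
    (hcont : ∀ y, ContinuousOn (fun θ => f θ y) Θ)
    -- Assumption A₀(Θ): ‖f_θ(0)‖_Θ < ∞
    (B : ℝ) (hB : ∀ θ ∈ Θ, l1 (f θ fun _ => 0) ≤ B)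
    -- Assumption A₀(Θ): Lipschitz condition with ∑ α_k < 1
    (α : ℕ → ℝ) (hαpos : ∀ k, 0 ≤ α k) (hαsum : Summable α) (hα1 : ∑' k, α k < 1)
    (hlip : ∀ θ ∈ Θ, ∀ y y' : ℕ → Fin m → ℕ,
      ENNReal.ofReal (l1 fun i => f θ y i - f θ y' i) ≤
        ∑' k, ENNReal.ofReal (α k * l1dist (y k) (y' k)))
    -- Assumption (MOD.A0): identifiability
    (hident : ∀ θ ∈ Θ,
      (∃ t : ℤ, ∀ᵐ ω ∂μ, f θstar (past Y t ω) = f θ (past Y t ω)) → θ = θstar)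
    -- Assumption (MOD.A0): uniform lower bound
    (c : ℝ) (hc : 0 < c) (hlb : ∀ θ ∈ Θ, ∀ y i, c ≤ f θ y i)
    -- α_k = O(k^{-γ}) for some γ > 3/2
    (hbigO : ∃ γ : ℝ, 3 / 2 < γ ∧
      (fun k : ℕ => α k) =O[atTop] fun k : ℕ => (k : ℝ) ^ (-γ))
    :
    ∀ᵐ ω ∂μ, Tendsto
      (fun n : ℕ => (1 / (n : ℝ)) *
        ⨆ θ : Θ, |LHat f Y n (θ : Fin d → ℝ) ω - L f Y n (θ : Fin d → ℝ) ω|)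
      atTop (𝓝 0) := by
  obtain ⟨γ, hγ, hO⟩ := hbigO
  have hint : ∀ t, Integrable (fun ω => l1n (Y t ω)) μ := by
    intro t
    refine integrable_finsetSum _ fun i _ => ?_
    by_contra hni
    have h0 := hcond t i
    rw [condExp_of_not_integrable hni] at h0
    obtain ⟨ω, hω⟩ := h0.exists
    exact absurd ((hlb θstar hθstar (past Y t ω) i).trans hω.symm.le) (not_le.2 hc)
  have hNmeas : ∀ t, Measurable fun ω => l1n (Y t ω) := fun t =>
    measurable_l1n.comp (hYmeas t)
  have hpath : Measurable fun ω (t : ℤ) => Y t ω := measurable_pi_lambda _ hYmeas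
  have : IsProbabilityMeasure (μ.map fun ω (t : ℤ) => Y t ω) :=
    Measure.isProbabilityMeasure_map hpath.aemeasurable
  have hg : Measurable fun x : ℤ → Fin m → ℕ => l1n (x 1) :=
    measurable_l1n.comp (measurable_pi_apply 1)
  have havg : ∀ᵐ ω ∂μ, ∃ K : ℝ, ∀ n : ℕ,
      ∑ s ∈ range n, l1n (Y ((s + 1 : ℕ) : ℤ) ω) ≤ K * n := by
    have h1 := ae_of_ae_map hpath.aemeasurable
      (ae_exists_birkhoffSum_le herg.toMeasurePreserving hg
        ((integrable_map_measure hg.aestronglyMeasurable hpath.aemeasurable).2 (hint 1))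
        fun x => l1n_nonneg _)
    simpa only [birkhoffSum_shift] using h1
  have hsummable : ∀ {b : ℕ → ℝ}, (∀ j, 0 ≤ b j) → Summable b →
      ∀ᵐ ω ∂μ, Summable fun j : ℕ => b j * l1n (Y (-(j : ℤ)) ω) := fun hb0 hb =>
    ae_summable_mul μ (fun j => hNmeas _) (fun j ω => l1n_nonneg _)
      (hint 0).lintegral_lt_top.ne
      (fun j => (lintegral_comp_eq_of_stationary hYmeas herg.toMeasurePreserving
        measurable_l1n.ennreal_ofReal _).le) hb0 hb
  have hpow : Summable fun j : ℕ => ((j + 1 : ℕ) : ℝ) ^ (-γ) :=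
    (summable_nat_add_iff 1).2 (Real.summable_nat_rpow.2 (by linarith))
  have hshift : ∀ᵐ ω ∂μ, ∀ s : ℕ, Summable fun j : ℕ => α (s + j) * l1n (Y (-(j : ℤ)) ω) :=
    ae_all_iff.2 fun s => hsummable (fun j => hαpos _)
      (hαsum.comp_injective (add_right_injective s))
  filter_upwards [havg, hshift, hsummable (fun j => by positivity) hpow] with ω ⟨K, hK⟩ hsh hpw
  set r : ℕ → ℝ := fun s => ∑' j : ℕ, α (s + j) * l1n (Y (-(j : ℤ)) ω) with hr
  set w : ℕ → ℝ := fun s => 1 + l1n (Y ((s + 1 : ℕ) : ℤ) ω) / c with hw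
  have hterm0 : ∀ s j : ℕ, 0 ≤ α (s + j) * l1n (Y (-(j : ℤ)) ω) := fun s j =>
    mul_nonneg (hαpos _) (l1n_nonneg _)
  have hr0 : ∀ s, 0 ≤ r s := fun s => tsum_nonneg (hterm0 s)
  have hrlim : Tendsto r atTop (𝓝 0) :=
    tendsto_tsum_shift_mul (by linarith) hαpos (fun j => l1n_nonneg _) hO
      hαsum.tendsto_atTop_zero hpw
  have hw1 : ∀ s, 1 ≤ w s := fun s =>
    le_add_of_nonneg_right (div_nonneg (l1n_nonneg _) hc.le)
  have hwK : ∀ n : ℕ, ∑ s ∈ range n, w s ≤ (1 + K / c) * n := by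
    intro n
    have h1 : (∑ s ∈ range n, l1n (Y ((s + 1 : ℕ) : ℤ) ω)) / c ≤ K * n / c :=
      div_le_div_of_nonneg_right (hK n) hc.le
    simp only [hw, Finset.sum_add_distrib, Finset.sum_const, Finset.card_range, nsmul_eq_mul,
      mul_one, ← Finset.sum_div]
    linarith [show K * n / c = K / c * n by ring]
  have hterm : ∀ θ ∈ Θ, ∀ s : ℕ,
      |ellHat f Y θ ((s + 1 : ℕ) : ℤ) ω - ell f Y θ ((s + 1 : ℕ) : ℤ) ω| ≤ w s * r s := by
    intro θ hθ s
    refine (abs_poisson_sub_le hc _ (hlb θ hθ _) (hlb θ hθ _)).trans ?_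
    refine mul_le_mul_of_nonneg_left ?_ (zero_le_one.trans (hw1 s))
    have h1 := hlip θ hθ (pastTrunc Y ((s + 1 : ℕ) : ℤ) ω) (past Y ((s + 1 : ℕ) : ℤ) ω)
    rw [tsum_past_trunc, ← ENNReal.ofReal_tsum_of_nonneg (hterm0 s) (hsh s)] at h1
    exact (ENNReal.ofReal_le_ofReal_iff (hr0 s)).1 h1
  have hLbound : ∀ (n : ℕ), ∀ θ ∈ Θ,
      |LHat f Y n θ ω - L f Y n θ ω| ≤ ∑ s ∈ range n, w s * r s := by
    intro n θ hθ
    rw [LHat, L, ← Finset.sum_sub_distrib, Finset.range_eq_Ico,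
      ← Finset.Ico_add_one_right_eq_Icc, Finset.sum_Ico_eq_sum_range, ← Finset.range_eq_Ico]
    refine (Finset.abs_sum_le_sum_abs _ _).trans ?_
    rw [Nat.add_sub_cancel]
    refine Finset.sum_le_sum fun s _ => ?_
    rw [add_comm 1 s]
    exact hterm θ hθ s
  have : Nonempty Θ := ⟨⟨θstar, hθstar⟩⟩
  refine squeeze_zero (fun n => ?_) (fun n => ?_) (tendsto_weighted_average hw1 hwK hrlim)
  · exact mul_nonneg (by positivity) (Real.iSup_nonneg fun _ => abs_nonneg _)
  · exact mul_le_mul_of_nonneg_left (ciSup_le fun θ => hLbound n θ θ.2) (by positivity)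

end ChangePointMOD
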